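/- arXiv:1406.6741 — 3 statements merged into one kernel-verified Lean document; each statement's English description precedes it below -/
import Mathlib

section
/- Let A be a point of the Euclidean plane, let u₁, u₂ be unit vectors with ⟪u₁,u₂⟫ = cos α₀ for some α₀ ∈ (0,π), and let α₁, α₂ ∈ (0,π) satisfy α₀ + α₁ + α₂ < π. Then there exist unit vectors w₁ and w₂ with the following two properties. (1) For every point O and every R > 0: the circle (O,R) is tangent to both rays A+ℝ₊w₁ and A+ℝ₊w₂ at points with positive parameter if and only if dist(A,O) > R, the circle meets both rays A+ℝ₊u₁ and A+ℝ₊u₂, and it meets the first ray at angle α₁ and the second ray at angle α₂ (in the sense defined in the context). (2) If a circle (O,R), R > 0, is tangent to the ray A+ℝ₊w₁ at a point with positive parameter and meets the ray A+ℝ₊u₁ at angle α₁, then it is also tangent to the ray A+ℝ₊w₂ at a point with positive parameter and meets the ray A+ℝ₊u₂ at angle α₂. -/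
open scoped RealInnerProductSpace
open Real EuclideanGeometry

noncomputable section

/-- The Euclidean plane. -/
abbrev E2 := EuclideanSpace ℝ (Fin 2)

/-- The circle of center `O` and radius `R` is tangent to the ray `A + ℝ₊·w`
(`w` a unit direction) at a point with positive parameter: there is `t > 0` with
`dist O (A + t•w) = R` and `O - (A + t•w)` orthogonal to `w`. -/
def IsTangentRay (A w O : E2) (R : ℝ) : Prop :=
  ∃ t : ℝ, 0 < t ∧ dist O (A + t • w) = R ∧ ⟪O - (A + t • w), w⟫ = 0

/-- The circle of center `O` and radius `R` meets the ray `A + ℝ₊·u`. -/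
def MeetsRay (A u O : E2) (R : ℝ) : Prop :=
  ∃ t : ℝ, 0 < t ∧ dist O (A + t • u) = R

/-- The circle of center `O` and radius `R` meets the ray `A + ℝ₊·u` at the angle
`α ∈ (0,π)`:  at the farthest intersection point `Q = A + t•u` of the circle with the
ray, the angle `∠ O Q A` equals `|π/2 − α|`, and the center `O` lies on the side of the
ray prescribed by the sign of `π/2 − α`, where `n` is the component of the direction of
the *other* ray orthogonal to `u` (so that the angle is measured inside the sector and
outside the circle). -/
def MeetsRayAtAngle (A u n O : E2) (R α : ℝ) : Prop :=
  ∃ t : ℝ, 0 < t ∧ dist O (A + t • u) = R ∧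
    (∀ s : ℝ, 0 < s → dist O (A + s • u) = R → s ≤ t) ∧
    ∠ O (A + t • u) A = |π / 2 - α| ∧
    (α < π / 2 → 0 < ⟪O - A, n⟫) ∧
    (α = π / 2 → ⟪O - A, n⟫ = 0) ∧
    (π / 2 < α → ⟪O - A, n⟫ < 0)

theorem norm_sq_eq_inner_sq_add_inner_sq {e f : E2} (he : ‖e‖ = 1) (hf : ‖f‖ = 1)
    (hef : ⟪e, f⟫ = 0) (v : E2) : ‖v‖ ^ 2 = ⟪v, e⟫ ^ 2 + ⟪v, f⟫ ^ 2 := by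
  have hon : Orthonormal ℝ ![e, f] := by
    simp [he, hf, hef]
  obtain ⟨b, hb⟩ := Orthonormal.exists_orthonormalBasis_extension_of_card_eq (𝕜 := ℝ)
    (E := E2) (ι := Fin 2) (v := ![e, f]) (s := Set.univ) (by simp)
    (hon.comp _ Subtype.val_injective)
  have h0 : b 0 = e := hb 0 trivial
  have h1 : b 1 = f := hb 1 trivial
  have h := b.sum_sq_norm_inner_left v
  simp only [Fin.sum_univ_two, h0, h1, Real.norm_eq_abs, sq_abs] at h
  exact h.symm

theorem dist_ray_sq {A u O : E2} (hu : ‖u‖ = 1) (t : ℝ) :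
    dist O (A + t • u) ^ 2 = ‖O - A‖ ^ 2 - 2 * t * ⟪O - A, u⟫ + t ^ 2 := by
  rw [dist_eq_norm, ← sub_sub, norm_sub_sq_real, inner_smul_right, norm_smul, hu, mul_one,
    Real.norm_eq_abs, sq_abs]
  ring

theorem dist_ray_eq_iff {A u O : E2} {R : ℝ} (hR : 0 < R) (hu : ‖u‖ = 1) (t : ℝ) :
    dist O (A + t • u) = R ↔ ‖O - A‖ ^ 2 - 2 * t * ⟪O - A, u⟫ + t ^ 2 = R ^ 2 := by
  rw [← dist_ray_sq hu, sq_eq_sq₀ dist_nonneg hR.le]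

theorem isTangentRay_iff {A w O : E2} {R : ℝ} (hR : 0 < R) (hw : ‖w‖ = 1) :
    IsTangentRay A w O R ↔ 0 < ⟪O - A, w⟫ ∧ ‖O - A‖ ^ 2 = ⟪O - A, w⟫ ^ 2 + R ^ 2 := by
  have hinner (t : ℝ) : ⟪O - (A + t • w), w⟫ = ⟪O - A, w⟫ - t := by
    rw [← sub_sub, inner_sub_left, real_inner_smul_left, real_inner_self_eq_norm_sq, hw]
    ring
  simp only [IsTangentRay, dist_ray_eq_iff hR hw, hinner]
  constructor
  · rintro ⟨t, ht, h, h'⟩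
    obtain rfl : t = ⟪O - A, w⟫ := by linarith
    exact ⟨ht, by linarith⟩
  · rintro ⟨h, h'⟩
    exact ⟨_, h, by linarith, by ring⟩

theorem MeetsRayAtAngle.meetsRay {A u n O : E2} {R α : ℝ} (h : MeetsRayAtAngle A u n O R α) :
    MeetsRay A u O R := by
  obtain ⟨t, ht, h, -⟩ := h
  exact ⟨t, ht, h⟩

theorem meetsRayAtAngle_iff {A u f n O : E2} {R α s : ℝ} (hR : 0 < R)
    (hα : α ∈ Set.Ioo 0 π) (hu : ‖u‖ = 1) (hf : ‖f‖ = 1) (huf : ⟪u, f⟫ = 0) (hs : 0 < s)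
    (hn : n = s • f) :
    MeetsRayAtAngle A u n O R α ↔
      ⟪O - A, f⟫ = R * cos α ∧ 0 < ⟪O - A, u⟫ + R * sin α := by
  have hN := norm_sq_eq_inner_sq_add_inner_sq hu hf huf (O - A)
  have hsin : 0 < sin α := sin_pos_of_mem_Ioo hα
  have hsc := sin_sq_add_cos_sq α
  have hdist (t : ℝ) : dist O (A + t • u) = R ↔
      (⟪O - A, u⟫ - t) ^ 2 + ⟪O - A, f⟫ ^ 2 = R ^ 2 := by
    rw [dist_ray_eq_iff hR hu, hN]
    constructor <;> intro h <;> linarith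
  have hangle (t : ℝ) (ht : 0 < t) (hd : dist O (A + t • u) = R) :
      ∠ O (A + t • u) A = |π / 2 - α| ↔ t - ⟪O - A, u⟫ = R * sin α := by
    have h1 : ⟪O - (A + t • u), A - (A + t • u)⟫ = t * (t - ⟪O - A, u⟫) := by
      rw [sub_add_cancel_left, ← sub_sub, inner_neg_right, inner_sub_left, inner_smul_right,
        real_inner_smul_left, inner_smul_right, real_inner_self_eq_norm_sq, hu]
      ring
    have h2 : ‖A - (A + t • u)‖ = t := by
      rw [sub_add_cancel_left, norm_neg, norm_smul, hu, mul_one, Real.norm_of_nonneg ht.le]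
    have h3 : cos (∠ O (A + t • u) A) = (t - ⟪O - A, u⟫) / R := by
      rw [EuclideanGeometry.angle, InnerProductGeometry.cos_angle, vsub_eq_sub, vsub_eq_sub, h1,
        h2, ← dist_eq_norm, hd]
      field_simp
    have h4 : cos |π / 2 - α| = sin α := by rw [cos_abs, cos_pi_div_two_sub]
    have h5 : |π / 2 - α| ∈ Set.Icc 0 π := by
      refine ⟨abs_nonneg _, ?_⟩
      rw [abs_le]
      constructor <;> linarith [hα.1, hα.2]
    rw [← injOn_cos.eq_iff ⟨angle_nonneg _ _ _, angle_le_pi _ _ _⟩ h5, h3, h4,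
      div_eq_iff hR.ne', mul_comm R]
  have hsign : ⟪O - A, n⟫ = s * ⟪O - A, f⟫ := by rw [hn, inner_smul_right]
  constructor
  · rintro ⟨t, ht, hd, -, ha, hlt, heq, hgt⟩
    rw [hangle t ht hd] at ha
    rw [hdist] at hd
    rw [hsign] at hlt heq hgt
    refine ⟨?_, by linarith⟩
    have hsq : ⟪O - A, f⟫ ^ 2 = (R * cos α) ^ 2 := by
      rw [← neg_sub, neg_sq, ha] at hd
      linear_combination hd - R ^ 2 * hsc
    rcases lt_trichotomy α (π / 2) with h | h | h
    · have hc : 0 < cos α := cos_pos_of_mem_Ioo ⟨by linarith [hα.1, pi_pos], h⟩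
      have := (mul_pos_iff_of_pos_left hs).1 (hlt h)
      exact (sq_eq_sq₀ this.le (by positivity)).1 hsq
    · rw [h, cos_pi_div_two, mul_zero]
      simpa [hs.ne'] using heq h
    · have hc : cos α < 0 := cos_neg_of_pi_div_two_lt_of_lt h (by linarith [hα.2, pi_pos])
      have h6 : ⟪O - A, f⟫ < 0 := by
        by_contra! h7
        exact absurd (hgt h) (not_lt.2 (by positivity))
      have h7 : R * cos α < 0 := mul_neg_of_pos_of_neg hR hc
      rcases sq_eq_sq_iff_eq_or_eq_neg.1 hsq with h8 | h8
      · exact h8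
      · linarith
  · rintro ⟨hf', hpos⟩
    have hd : dist O (A + (⟪O - A, u⟫ + R * sin α) • u) = R := by
      rw [hdist, hf']
      linear_combination R ^ 2 * hsc
    refine ⟨_, hpos, hd, fun r _ hr => ?_, (hangle _ hpos hd).2 (by ring), ?_, ?_, ?_⟩
    · rw [hdist, hf'] at hr
      have : (r - ⟪O - A, u⟫) ^ 2 = (R * sin α) ^ 2 := by
        linear_combination hr - R ^ 2 * hsc
      linarith [le_of_sq_le_sq this.le (by positivity)]
    · intro h
      have hc : 0 < cos α := cos_pos_of_mem_Ioo ⟨by linarith [hα.1, pi_pos], h⟩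
      rw [hsign, hf']
      positivity
    · intro h
      rw [hsign, hf', h, cos_pi_div_two]
      ring
    · intro h
      have hc : cos α < 0 := cos_neg_of_pi_div_two_lt_of_lt h (by linarith [hα.2, pi_pos])
      rw [hsign, hf']
      exact mul_neg_of_pos_of_neg hs (mul_neg_of_pos_of_neg hR hc)

theorem cos_add_cos_pos {a b : ℝ} (h₁ : |a| + |b| < π) : 0 < cos a + cos b := by
  have h : cos (π - |b|) < cos |a| :=
    cos_lt_cos_of_nonneg_of_le_pi (abs_nonneg a) (by linarith [abs_nonneg b]) (by linarith)
  rw [cos_pi_sub, cos_abs, cos_abs] at h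
  linarith

theorem exists_tangent_directions {v₁ v₂ s : ℝ} (hs : 0 < s) (hsv : s ^ 2 + v₂ ^ 2 = 1)
    (hv : s < v₁) :
    ∃ p₁ q₁ p₂ q₂ : ℝ, p₁ ^ 2 + q₁ ^ 2 = 1 ∧ p₂ ^ 2 + q₂ ^ 2 = 1 ∧ q₁ < 0 ∧
      v₁ * q₁ - v₂ * p₁ = -1 ∧ v₁ * q₂ - v₂ * p₂ = 1 ∧
      0 < v₁ * p₁ + v₂ * q₁ ∧ 0 < v₁ * p₂ + v₂ * q₂ ∧
      ∀ x y R : ℝ, 0 < R → 0 < x * p₁ + y * q₁ → 0 < x * p₂ + y * q₂ →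
        (x * q₁ - y * p₁) ^ 2 = R ^ 2 → (x * q₂ - y * p₂) ^ 2 = R ^ 2 →
        x = R * v₁ ∧ y = R * v₂ := by
  set N := v₁ ^ 2 + v₂ ^ 2 with hN
  have hN1 : 0 < N - 1 := by nlinarith
  have hN0 : 0 < N := by linarith
  set τ := √(N - 1) with hτ
  have hτ0 : 0 < τ := sqrt_pos.2 hN1
  have hτ2 : τ ^ 2 = N - 1 := sq_sqrt hN1.le
  refine ⟨(τ * v₁ + v₂) / N, (τ * v₂ - v₁) / N, (τ * v₁ - v₂) / N, (τ * v₂ + v₁) / N,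
    ?_, ?_, ?_, ?_, ?_, ?_, ?_, ?_⟩
  · field_simp
    linear_combination (v₁ ^ 2 + v₂ ^ 2) * hτ2 - N * hN
  · field_simp
    linear_combination (v₁ ^ 2 + v₂ ^ 2) * hτ2 - N * hN
  · refine div_neg_of_neg_of_pos (sub_neg.2 (lt_of_pow_lt_pow_left₀ 2 (by linarith) ?_)) hN0
    have h : (τ * v₂) ^ 2 = v₁ ^ 2 - s ^ 2 * (v₁ ^ 2 + v₂ ^ 2) := by
      linear_combination v₂ ^ 2 * hτ2 + v₂ ^ 2 * hN + (v₁ ^ 2 + v₂ ^ 2) * hsv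
    rw [h]
    have : 0 < s ^ 2 * (v₁ ^ 2 + v₂ ^ 2) := by positivity
    linarith
  · field_simp
    linear_combination hN
  · field_simp
    linear_combination -hN
  · have : v₁ * ((τ * v₁ + v₂) / N) + v₂ * ((τ * v₂ - v₁) / N) = τ := by
      field_simp
      linear_combination -τ * hN
    rwa [this]
  · have : v₁ * ((τ * v₁ - v₂) / N) + v₂ * ((τ * v₂ + v₁) / N) = τ := by
      field_simp
      linear_combination -τ * hN
    rwa [this]
  · intro x y R hR h₁ h₂ h₃ h₄
    have hsum : x * ((τ * v₁ + v₂) / N) + y * ((τ * v₂ - v₁) / N) +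
        (x * ((τ * v₁ - v₂) / N) + y * ((τ * v₂ + v₁) / N)) =
        2 * τ / N * (x * v₁ + y * v₂) := by
      field_simp
      ring
    have ha : 0 < x * v₁ + y * v₂ :=
      (mul_pos_iff_of_pos_left (by positivity : 0 < 2 * τ / N)).1 (by linarith)
    have hb : y * v₁ - x * v₂ = 0 := by
      have h := h₃.trans h₄.symm
      field_simp at h
      have : (x * v₁ + y * v₂) * τ * (y * v₁ - x * v₂) = 0 := by linear_combination h / 4
      simpa [ha.ne', hτ0.ne'] using this
    have hc : x * v₁ + y * v₂ = N * R := by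
      refine (sq_eq_sq₀ ha.le (by positivity)).1 ?_
      field_simp at h₄
      linear_combination h₄ + τ * (2 * (x * v₁ + y * v₂) - τ * (y * v₁ - x * v₂)) * hb
    constructor
    · refine mul_left_cancel₀ hN0.ne' ?_
      linear_combination v₁ * hc - v₂ * hb + x * hN
    · refine mul_left_cancel₀ hN0.ne' ?_
      linear_combination v₂ * hc + v₁ * hb + y * hN

/-- Given two rays from `A` in unit directions `u₁, u₂` making an
angle `α₀ ∈ (0,π)`, and angles `α₁, α₂ ∈ (0,π)` with `α₀ + α₁ + α₂ < π`, there exist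
two auxiliary rays from `A`, in unit directions `w₁, w₂`, such that:
(1) a circle is tangent to both auxiliary rays iff its center lies outside the circle,
it meets both original rays, and it meets them at the angles `α₁` and `α₂` respectively;
(2) if a circle is tangent to the first auxiliary ray and meets the first original ray
at angle `α₁`, then it is automatically tangent to the second auxiliary ray and meets
the second original ray at angle `α₂`. -/
theorem auxiliary_tangent_rays
    (A u₁ u₂ : E2) (α₀ α₁ α₂ : ℝ)
    (hu₁ : ‖u₁‖ = 1) (hu₂ : ‖u₂‖ = 1)
    (hα₀ : α₀ ∈ Set.Ioo 0 π) (hcos : ⟪u₁, u₂⟫ = Real.cos α₀)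
    (hα₁ : α₁ ∈ Set.Ioo 0 π) (hα₂ : α₂ ∈ Set.Ioo 0 π)
    (hsum : α₀ + α₁ + α₂ < π) :
    ∃ w₁ w₂ : E2, ‖w₁‖ = 1 ∧ ‖w₂‖ = 1 ∧
      (∀ (O : E2) (R : ℝ), 0 < R →
        ((IsTangentRay A w₁ O R ∧ IsTangentRay A w₂ O R) ↔
          (R < dist A O ∧ MeetsRay A u₁ O R ∧ MeetsRay A u₂ O R ∧
            MeetsRayAtAngle A u₁ (u₂ - ⟪u₂, u₁⟫ • u₁) O R α₁ ∧
            MeetsRayAtAngle A u₂ (u₁ - ⟪u₁, u₂⟫ • u₂) O R α₂))) ∧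
      (∀ (O : E2) (R : ℝ), 0 < R →
        IsTangentRay A w₁ O R →
        MeetsRayAtAngle A u₁ (u₂ - ⟪u₂, u₁⟫ • u₁) O R α₁ →
        (IsTangentRay A w₂ O R ∧
          MeetsRayAtAngle A u₂ (u₁ - ⟪u₁, u₂⟫ • u₂) O R α₂)) := by
  have hs₀ : 0 < sin α₀ := sin_pos_of_mem_Ioo hα₀
  have hs₁ : 0 < sin α₁ := sin_pos_of_mem_Ioo hα₁
  have hsc₀ := sin_sq_add_cos_sq α₀
  have hsc₁ := sin_sq_add_cos_sq α₁
  have hcos' : ⟪u₂, u₁⟫ = cos α₀ := by rw [real_inner_comm, hcos]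
  have huu₁ : ⟪u₁, u₁⟫ = 1 := by rw [real_inner_self_eq_norm_sq, hu₁, one_pow]
  have huu₂ : ⟪u₂, u₂⟫ = 1 := by rw [real_inner_self_eq_norm_sq, hu₂, one_pow]
  rw [hcos, hcos']
  obtain ⟨f, hf⟩ : ∃ f : E2, f = (sin α₀)⁻¹ • (u₂ - cos α₀ • u₁) := ⟨_, rfl⟩
  have hn₁ : u₂ - cos α₀ • u₁ = sin α₀ • f := by rw [hf, smul_inv_smul₀ hs₀.ne']
  have hu₂f : u₂ = cos α₀ • u₁ + sin α₀ • f := by rw [← hn₁]; abel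
  have huf : ⟪u₁, f⟫ = 0 := by
    rw [hf, inner_smul_right, inner_sub_right, inner_smul_right, hcos, huu₁]
    ring
  have hfu : ⟪f, u₁⟫ = 0 := by rw [real_inner_comm, huf]
  have hff : ⟪f, f⟫ = 1 := by
    have h : sin α₀ ^ 2 * ⟪f, f⟫ = sin α₀ ^ 2 := by
      have h' : ⟪sin α₀ • f, sin α₀ • f⟫ = sin α₀ ^ 2 := by
        rw [← hn₁]
        simp only [inner_sub_left, inner_sub_right, real_inner_smul_left, inner_smul_right,
          huu₁, huu₂, hcos, hcos']
        linear_combination -hsc₀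
      rw [real_inner_smul_left, inner_smul_right] at h'
      linear_combination h'
    exact mul_left_cancel₀ (pow_ne_zero 2 hs₀.ne') (by rw [h, mul_one])
  have hnorm {p q : ℝ} (h : p ^ 2 + q ^ 2 = 1) : ‖p • u₁ + q • f‖ = 1 := by
    rw [← sq_eq_sq₀ (norm_nonneg _) zero_le_one, ← real_inner_self_eq_norm_sq]
    simp only [inner_add_left, inner_add_right, real_inner_smul_left, inner_smul_right,
      huu₁, hff, huf, hfu]
    linear_combination h
  have hf1 : ‖f‖ = 1 := by simpa using hnorm (p := 0) (q := 1) (by norm_num)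
  obtain ⟨g, hg⟩ : ∃ g : E2, g = sin α₀ • u₁ + (-cos α₀) • f := ⟨_, rfl⟩
  have hg1 : ‖g‖ = 1 := by rw [hg]; exact hnorm (by linear_combination hsc₀)
  have hug : ⟪u₂, g⟫ = 0 := by
    rw [hu₂f, hg]
    simp only [inner_add_left, inner_add_right, real_inner_smul_left, inner_smul_right,
      huu₁, hff, huf, hfu]
    ring
  have hn₂ : u₁ - cos α₀ • u₂ = sin α₀ • g := by
    rw [hu₂f, hg]
    match_scalars
    · linear_combination -hsc₀
    · ring
  obtain ⟨v₁, hv₁⟩ : ∃ v : ℝ, v = (cos α₂ + cos α₀ * cos α₁) / sin α₀ := ⟨_, rfl⟩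
  have hv₁' : v₁ * sin α₀ = cos α₂ + cos α₀ * cos α₁ := by
    rw [hv₁, div_mul_cancel₀ _ hs₀.ne']
  obtain ⟨a0, -⟩ := id hα₀
  obtain ⟨a1, -⟩ := id hα₁
  obtain ⟨a2, -⟩ := id hα₂
  have hlt : sin α₁ < v₁ := by
    have h := cos_add_cos_pos (a := α₂) (b := α₀ + α₁)
      (by rw [abs_of_pos a2, abs_of_pos (by linarith)]; linarith)
    rw [cos_add] at h
    refine lt_of_mul_lt_mul_right ?_ hs₀.le
    linarith
  have hpos₂ : 0 < v₁ * cos α₀ + cos α₁ * sin α₀ + sin α₂ := by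
    have h := cos_add_cos_pos (a := α₁) (b := α₀ - α₂)
      (by rw [abs_of_pos a1]; rcases abs_cases (α₀ - α₂) with h | h <;> linarith)
    rw [cos_sub] at h
    refine pos_of_mul_pos_left ?_ hs₀.le
    linear_combination h - cos α₀ * hv₁' - cos α₁ * hsc₀
  obtain ⟨p₁, q₁, p₂, q₂, hpq₁, hpq₂, hq₁, hx₁, hx₂, hd₁, hd₂, huniq⟩ :=
    exists_tangent_directions hs₁ hsc₁ hlt
  refine ⟨p₁ • u₁ + q₁ • f, p₂ • u₁ + q₂ • f, hnorm hpq₁, hnorm hpq₂, ?_⟩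
  have hNorm (O : E2) := norm_sq_eq_inner_sq_add_inner_sq hu₁ hf1 huf (O - A)
  have htan {p q : ℝ} (h : p ^ 2 + q ^ 2 = 1) (O : E2) (R : ℝ) (hR : 0 < R) :
      IsTangentRay A (p • u₁ + q • f) O R ↔ 0 < ⟪O - A, u₁⟫ * p + ⟪O - A, f⟫ * q ∧
        (⟪O - A, u₁⟫ * q - ⟪O - A, f⟫ * p) ^ 2 = R ^ 2 := by
    rw [isTangentRay_iff hR (hnorm h), hNorm, inner_add_right, inner_smul_right,
      inner_smul_right, mul_comm p, mul_comm q]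
    refine and_congr_right fun _ => ⟨fun h' => ?_, fun h' => ?_⟩
    · linear_combination h' + (⟪O - A, u₁⟫ ^ 2 + ⟪O - A, f⟫ ^ 2) * h
    · linear_combination h' - (⟪O - A, u₁⟫ ^ 2 + ⟪O - A, f⟫ ^ 2) * h
  have hangle₁ (O : E2) (R : ℝ) (hR : 0 < R) := meetsRayAtAngle_iff (A := A) (O := O) hR hα₁
    hu₁ hf1 huf hs₀ hn₁
  have hangle₂ (O : E2) (R : ℝ) (hR : 0 < R) := meetsRayAtAngle_iff (A := A) (O := O) hR hα₂
    hu₂ hg1 hug hs₀ hn₂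
  have hinner_g (O : E2) :
      ⟪O - A, g⟫ = sin α₀ * ⟪O - A, u₁⟫ - cos α₀ * ⟪O - A, f⟫ := by
    rw [hg, inner_add_right, inner_smul_right, inner_smul_right]
    ring
  have hinner_u₂ (O : E2) :
      ⟪O - A, u₂⟫ = cos α₀ * ⟪O - A, u₁⟫ + sin α₀ * ⟪O - A, f⟫ := by
    conv_lhs => rw [hu₂f, inner_add_right, inner_smul_right, inner_smul_right]
  have hall (O : E2) (R : ℝ) (hR : 0 < R) (hx : ⟪O - A, u₁⟫ = R * v₁)
      (hy : ⟪O - A, f⟫ = R * cos α₁) :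
      IsTangentRay A (p₁ • u₁ + q₁ • f) O R ∧ IsTangentRay A (p₂ • u₁ + q₂ • f) O R ∧
        R < dist A O ∧ MeetsRayAtAngle A u₁ (u₂ - cos α₀ • u₁) O R α₁ ∧
        MeetsRayAtAngle A u₂ (u₁ - cos α₀ • u₂) O R α₂ := by
    rw [htan hpq₁ O R hR, htan hpq₂ O R hR, hangle₁ O R hR, hangle₂ O R hR, hinner_g,
      hinner_u₂, hx, hy]
    refine ⟨⟨?_, ?_⟩, ⟨?_, ?_⟩, ?_, ⟨rfl, ?_⟩, ?_, ?_⟩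
    · linear_combination mul_pos hR hd₁
    · linear_combination R ^ 2 * (v₁ * q₁ - cos α₁ * p₁ - 1) * hx₁
    · linear_combination mul_pos hR hd₂
    · linear_combination R ^ 2 * (v₁ * q₂ - cos α₁ * p₂ + 1) * hx₂
    · rw [dist_comm, dist_eq_norm]
      refine lt_of_pow_lt_pow_left₀ 2 (norm_nonneg _) ?_
      rw [hNorm, hx, hy]
      have : 0 < R ^ 2 * ((v₁ - sin α₁) * (v₁ + sin α₁)) :=
        mul_pos (by positivity) (mul_pos (by linarith) (by linarith))
      linear_combination this - R ^ 2 * hsc₁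
    · have : 0 < v₁ := hs₁.trans hlt
      positivity
    · linear_combination R * hv₁'
    · linear_combination mul_pos hR hpos₂
  constructor
  · intro O R hR
    constructor
    · rintro ⟨h₁, h₂⟩
      rw [htan hpq₁ O R hR] at h₁
      rw [htan hpq₂ O R hR] at h₂
      obtain ⟨hx, hy⟩ := huniq _ _ R hR h₁.1 h₂.1 h₁.2 h₂.2
      obtain ⟨-, -, hd, hm₁, hm₂⟩ := hall O R hR hx hy
      exact ⟨hd, hm₁.meetsRay, hm₂.meetsRay, hm₁, hm₂⟩
    · rintro ⟨-, -, -, h₁, h₂⟩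
      rw [hangle₁ O R hR] at h₁
      rw [hangle₂ O R hR, hinner_g, h₁.1] at h₂
      have hx : ⟪O - A, u₁⟫ = R * v₁ := by
        refine mul_left_cancel₀ hs₀.ne' ?_
        linear_combination h₂.1 - R * hv₁'
      obtain ⟨ht₁, ht₂, -⟩ := hall O R hR hx h₁.1
      exact ⟨ht₁, ht₂⟩
  · intro O R hR ht hm
    rw [htan hpq₁ O R hR] at ht
    rw [hangle₁ O R hR] at hm
    obtain ⟨hy, hpos⟩ := hm
    have hx : ⟪O - A, u₁⟫ = R * v₁ := by
      have h := ht.2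
      rw [hy] at h
      rcases sq_eq_sq_iff_eq_or_eq_neg.1 h with h | h
      · have h1 : ⟪O - A, u₁⟫ * q₁ + R * sin α₁ * q₁ < 0 := by
          rw [← add_mul]
          exact mul_neg_of_pos_of_neg hpos hq₁
        have h2 : R * (1 + cos α₁ * p₁ + sin α₁ * q₁) < 0 := by linear_combination h1 - h
        have h3 : 1 + cos α₁ * p₁ + sin α₁ * q₁ < 0 := by
          by_contra! h4
          exact absurd h2 (not_lt.2 (by positivity))
        linarith [sq_nonneg (cos α₁ + p₁), sq_nonneg (sin α₁ + q₁)]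
      · refine mul_right_cancel₀ hq₁.ne ?_
        linear_combination h - R * hx₁
    obtain ⟨-, ht₂, -, -, hm₂⟩ := hall O R hR hx hy
    exact ⟨ht₂, hm₂⟩
end
end

section
/- Let α_ij, α_jk, α_ki ∈ [0,π) and β_i, β_j, β_k ∈ (0,π) satisfy β_i + β_j + β_k = π, α_ij + β_i + α_ki ≤ π, α_ij + α_jk + β_j ≤ π, and α_jk + β_k + α_ki ≤ π. Then there exist affinely independent points i, j, k in the Euclidean plane, a point O, and a real R > 0 such that: (a) ∠ j i k = β_i, ∠ i j k = β_j, ∠ i k j = β_k; (b) for each edge — e.g. for the edge ij with opposite vertex k — if F is the orthogonal projection of O onto the line through i and j and n is the unit vector orthogonal to j − i with ⟪k − F, n⟫ > 0, then O = F + (R·cos α_ij)·n, and similarly for the edge jk (with α_jk and opposite vertex i) and the edge ki (with α_ki and opposite vertex j); (c) dist(O,u) ≥ R for each u ∈ {i,j,k} and, setting r_u = √(dist(O,u)² − R²), dist(u,v) ≥ r_u + r_v for each of the three edges. (Thus the six angles are realized by a Euclidean decorated triangle: the vertex circles of radii r_u have pairwise disjoint interiors and are orthogonal to the face circle (O,R),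 which meets each edge line at the prescribed angle.) -/
open scoped RealInnerProductSpace
open Real EuclideanGeometry

noncomputable section

/-- The face circle of center `O` and radius `R` crosses the edge `uv` (with opposite
vertex `w`) of a triangle at the angle `α`: if `F` is the orthogonal projection of `O`
onto the line through `u` and `v` (characterized by `F` lying on the line and `O - F`
being orthogonal to `v - u`), and `n` is the unit normal of the line pointing to the
side containing `w` (relative to `F`), then `O = F + (R·cos α)·n`, i.e. the signed
distance from `O` to the line equals `R·cos α`. -/
def FaceCircleCrossesEdge (u v w O : E2) (R α : ℝ) : Prop :=
  ∃ F n : E2, F ∈ affineSpan ℝ ({u, v} : Set E2) ∧ ⟪O - F, v - u⟫ = 0 ∧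
    ‖n‖ = 1 ∧ ⟪n, v - u⟫ = 0 ∧ 0 < ⟪w - F, n⟫ ∧
    O = F + (R * Real.cos α) • n

/-- A face circle whose center projects into the edge `uv`, at distance at least `R sin α` from
both endpoints, crosses the edge at angle `α`, and the orthogonal vertex circles at `u` and `v`
are real with disjoint interiors. -/
theorem faceCircleCrossesEdge_of_frame {u v w O e n : E2} {l x p q R α : ℝ}
    (he : ‖e‖ = 1) (hn : ‖n‖ = 1) (hne : ⟪n, e⟫ = 0) (hl : 0 < l) (hq : 0 < q) (hR : 0 ≤ R)
    (hα : 0 ≤ Real.sin α) (hx : R * Real.sin α ≤ x) (hlx : R * Real.sin α ≤ l - x)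
    (hv : v = u + l • e) (hw : w = u + p • e + q • n)
    (hO : O = u + x • e + (R * Real.cos α) • n) :
    FaceCircleCrossesEdge u v w O R α ∧ R ≤ dist O u ∧
      √(dist O u ^ 2 - R ^ 2) + √(dist O v ^ 2 - R ^ 2) ≤ dist u v := by
  have hnorm (a b : ℝ) : ‖a • e + b • n‖ ^ 2 = a ^ 2 + b ^ 2 := by
    rw [norm_add_sq_real, norm_smul, norm_smul, he, hn, real_inner_smul_left,
      real_inner_smul_right, real_inner_comm, hne]
    simp
  have hRα : 0 ≤ R * Real.sin α := mul_nonneg hR hα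
  have hdu : dist O u ^ 2 = x ^ 2 + (R * Real.cos α) ^ 2 := by
    rw [dist_eq_norm, ← hnorm, hO]
    congr 2
    module
  have hdv : dist O v ^ 2 = (l - x) ^ 2 + (R * Real.cos α) ^ 2 := by
    rw [dist_eq_norm, ← neg_sub, norm_neg, hO, hv, ← neg_sq (R * Real.cos α), ← hnorm]
    congr 2
    module
  have hduv : dist u v = l := by
    rw [hv, dist_self_add_right, norm_smul, he, mul_one, Real.norm_of_nonneg hl.le]
  have hR2 : R ^ 2 = (R * Real.sin α) ^ 2 + (R * Real.cos α) ^ 2 := by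
    linear_combination -R ^ 2 * Real.sin_sq_add_cos_sq α
  refine ⟨⟨u + x • e, n, ?_, ?_, hn, ?_, ?_, hO⟩, ?_, ?_⟩
  · convert AffineMap.lineMap_mem_affineSpan_pair (k := ℝ) (x / l) u v using 1
    rw [AffineMap.lineMap_apply, hv, vsub_eq_sub, vadd_eq_add, add_sub_cancel_left, smul_smul,
      div_mul_cancel₀ _ hl.ne', add_comm]
  · rw [hO, hv, add_sub_cancel_left, add_sub_cancel_left, real_inner_smul_left,
      real_inner_smul_right, hne, mul_zero, mul_zero]
  · rw [hv, add_sub_cancel_left, real_inner_smul_right, hne, mul_zero]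
  · have : w - (u + x • e) = (p - x) • e + q • n := by rw [hw]; module
    rw [this, inner_add_left, real_inner_smul_left, real_inner_smul_left, real_inner_comm, hne,
      real_inner_self_eq_norm_sq, hn]
    simpa using hq
  · refine abs_le_of_sq_le_sq' ?_ dist_nonneg |>.2
    rw [hdu, hR2]
    gcongr
  · rw [hduv, hdu, hdv]
    have h₁ : √(x ^ 2 + (R * Real.cos α) ^ 2 - R ^ 2) ≤ x :=
      Real.sqrt_le_iff.2 ⟨hRα.trans hx, by nlinarith⟩
    have h₂ : √((l - x) ^ 2 + (R * Real.cos α) ^ 2 - R ^ 2) ≤ l - x :=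
      Real.sqrt_le_iff.2 ⟨hRα.trans hlx, by nlinarith⟩
    linarith

theorem angle_eq_of_inner_eq_cos {u p q e f : E2} {a b β : ℝ} (he : ‖e‖ = 1) (hf : ‖f‖ = 1)
    (ha : 0 < a) (hb : 0 < b) (hβ : β ∈ Set.Ioo 0 π) (hef : ⟪e, f⟫ = Real.cos β)
    (hp : p = u + a • e) (hq : q = u + b • f) : ∠ p u q = β := by
  rw [EuclideanGeometry.angle, hp, hq, vsub_eq_sub, vsub_eq_sub, add_sub_cancel_left,
    add_sub_cancel_left, InnerProductGeometry.angle_smul_left_of_pos _ _ ha,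
    InnerProductGeometry.angle_smul_right_of_pos _ _ hb, InnerProductGeometry.angle, hef, he, hf,
    mul_one, div_one, Real.arccos_cos hβ.1.le hβ.2.le]

theorem sin_mul_sin_le_cos_add_cos_mul_cos {a b β : ℝ} (ha : 0 ≤ a) (hb : 0 ≤ b) (hβ : 0 ≤ β)
    (h : a + β + b ≤ π) :
    Real.sin β * Real.sin a ≤ Real.cos b + Real.cos a * Real.cos β := by
  have := Real.cos_le_cos_of_nonneg_of_le_pi hb (by linarith : π - (β + a) ≤ π) (by linarith)
  rw [Real.cos_pi_sub, Real.cos_add] at this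
  linarith

/-- Twice the area of the triangle cut out by the three edge lines is positive. -/
theorem sin_mul_cos_sum_pos {αij αjk αki βi βj βk : ℝ}
    (hαij : αij ∈ Set.Ico 0 π) (hαjk : αjk ∈ Set.Ico 0 π) (hαki : αki ∈ Set.Ico 0 π)
    (hβi : βi ∈ Set.Ioo 0 π) (hβj : βj ∈ Set.Ioo 0 π) (hβk : βk ∈ Set.Ioo 0 π)
    (hsum : βi + βj + βk = π)
    (hi : αij + βi + αki ≤ π) (hj : αij + αjk + βj ≤ π) (hk : αjk + βk + αki ≤ π) :
    0 < Real.sin βk * Real.cos αij + Real.sin βi * Real.cos αjk +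
      Real.sin βj * Real.cos αki := by
  have si := Real.sin_pos_of_mem_Ioo hβi
  have sj := Real.sin_pos_of_mem_Ioo hβj
  have sk := Real.sin_pos_of_mem_Ioo hβk
  have esum {a b c : ℝ} (h : a + b + c = π) :
      Real.sin c = Real.sin a * Real.cos b + Real.cos a * Real.sin b := by
    rw [← Real.sin_add, ← Real.sin_pi_sub c]
    congr 1
    linarith
  have i₁ := sin_mul_sin_le_cos_add_cos_mul_cos hαij.1 hαki.1 hβi.1.le hi
  have i₂ := sin_mul_sin_le_cos_add_cos_mul_cos hαki.1 hαij.1 hβi.1.le (by linarith)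
  have j₁ := sin_mul_sin_le_cos_add_cos_mul_cos hαij.1 hαjk.1 hβj.1.le (by linarith)
  have j₂ := sin_mul_sin_le_cos_add_cos_mul_cos hαjk.1 hαij.1 hβj.1.le (by linarith)
  have k₁ := sin_mul_sin_le_cos_add_cos_mul_cos hαjk.1 hαki.1 hβk.1.le hk
  have k₂ := sin_mul_sin_le_cos_add_cos_mul_cos hαki.1 hαjk.1 hβk.1.le (by linarith)
  rcases hαij.1.eq_or_lt with h₁ | h₁
  · rcases hαjk.1.eq_or_lt with h₂ | h₂
    · rcases hαki.1.eq_or_lt with h₃ | h₃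
      · rw [← h₁, ← h₂, ← h₃, Real.cos_zero]
        positivity
      · have := Real.sin_pos_of_pos_of_lt_pi h₃ hαki.2
        have hpos : 0 < Real.sin βi * Real.sin βk * Real.sin αki := by positivity
        rw [esum (by linarith : βk + βi + βj = π)]
        linarith [mul_le_mul_of_nonneg_left k₂ si.le, mul_le_mul_of_nonneg_left i₂ sk.le]
    · have := Real.sin_pos_of_pos_of_lt_pi h₂ hαjk.2
      have hpos : 0 < Real.sin βj * Real.sin βk * Real.sin αjk := by positivity
      rw [esum (by linarith : βj + βk + βi = π)]
      linarith [mul_le_mul_of_nonneg_left k₁ sj.le, mul_le_mul_of_nonneg_left j₂ sk.le]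
  · have := Real.sin_pos_of_pos_of_lt_pi h₁ hαij.2
    have hpos : 0 < Real.sin βi * Real.sin βj * Real.sin αij := by positivity
    rw [esum hsum]
    linarith [mul_le_mul_of_nonneg_left i₁ sj.le, mul_le_mul_of_nonneg_left j₁ si.le]

set_option maxHeartbeats 1000000 in
/-- Any admissible system of angles
`α_ij, α_jk, α_ki ∈ [0,π)`, `β_i, β_j, β_k ∈ (0,π)` with `β_i + β_j + β_k = π` and
`α_ij + β_i + α_ki ≤ π`, `α_ij + α_jk + β_j ≤ π`, `α_jk + β_k + α_ki ≤ π`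
is realized by a Euclidean decorated triangle: a nondegenerate triangle `ijk` with the
prescribed angles at its vertices, and a face circle `(O,R)` crossing each edge line at
the prescribed angle, such that the vertex circles of radii
`r_u = √(dist(O,u)² − R²)` (which are automatically orthogonal to `(O,R)`) have
pairwise disjoint interiors. -/
theorem decorated_triangle_from_angles
    (αij αjk αki βi βj βk : ℝ)
    (hαij : αij ∈ Set.Ico 0 π) (hαjk : αjk ∈ Set.Ico 0 π) (hαki : αki ∈ Set.Ico 0 π)
    (hβi : βi ∈ Set.Ioo 0 π) (hβj : βj ∈ Set.Ioo 0 π) (hβk : βk ∈ Set.Ioo 0 π)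
    (hsum : βi + βj + βk = π)
    (hi : αij + βi + αki ≤ π) (hj : αij + αjk + βj ≤ π) (hk : αjk + βk + αki ≤ π) :
    ∃ (i j k O : E2) (R : ℝ), 0 < R ∧
      AffineIndependent ℝ ![i, j, k] ∧
      ∠ j i k = βi ∧ ∠ i j k = βj ∧ ∠ i k j = βk ∧
      FaceCircleCrossesEdge i j k O R αij ∧
      FaceCircleCrossesEdge j k i O R αjk ∧
      FaceCircleCrossesEdge k i j O R αki ∧
      R ≤ dist O i ∧ R ≤ dist O j ∧ R ≤ dist O k ∧
      Real.sqrt (dist O i ^ 2 - R ^ 2) + Real.sqrt (dist O j ^ 2 - R ^ 2) ≤ dist i j ∧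
      Real.sqrt (dist O j ^ 2 - R ^ 2) + Real.sqrt (dist O k ^ 2 - R ^ 2) ≤ dist j k ∧
      Real.sqrt (dist O k ^ 2 - R ^ 2) + Real.sqrt (dist O i ^ 2 - R ^ 2) ≤ dist k i := by
  have hsinα {a : ℝ} (h : a ∈ Set.Ico 0 π) : 0 ≤ Real.sin a :=
    Real.sin_nonneg_of_nonneg_of_le_pi h.1 h.2.le
  have hij := hsinα hαij
  have hjk := hsinα hαjk
  have hki := hsinα hαki
  have si := Real.sin_pos_of_mem_Ioo hβi
  have sj := Real.sin_pos_of_mem_Ioo hβj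
  have sk := Real.sin_pos_of_mem_Ioo hβk
  have hβk' : βk = π - (βi + βj) := by linarith
  have esk : Real.sin βk = Real.sin βi * Real.cos βj + Real.cos βi * Real.sin βj := by
    rw [hβk', Real.sin_pi_sub, Real.sin_add]
  have eck : Real.cos βk = Real.sin βi * Real.sin βj - Real.cos βi * Real.cos βj := by
    rw [hβk', Real.cos_pi_sub, Real.cos_add]; ring
  have ti := Real.sin_sq_add_cos_sq βi
  have tj := Real.sin_sq_add_cos_sq βj
  have ei : Real.sin βi = Real.sin βj * Real.cos βk + Real.cos βj * Real.sin βk := by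
    rw [esk, eck]; linear_combination -Real.sin βi * tj
  have ej : Real.sin βj = Real.sin βk * Real.cos βi + Real.cos βk * Real.sin βi := by
    rw [esk, eck]; linear_combination -Real.sin βj * ti
  have i₁ := sin_mul_sin_le_cos_add_cos_mul_cos hαij.1 hαki.1 hβi.1.le hi
  have i₂ := sin_mul_sin_le_cos_add_cos_mul_cos hαki.1 hαij.1 hβi.1.le (by linarith)
  have j₁ := sin_mul_sin_le_cos_add_cos_mul_cos hαij.1 hαjk.1 hβj.1.le (by linarith)
  have j₂ := sin_mul_sin_le_cos_add_cos_mul_cos hαjk.1 hαij.1 hβj.1.le (by linarith)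
  have k₁ := sin_mul_sin_le_cos_add_cos_mul_cos hαjk.1 hαki.1 hβk.1.le hk
  have k₂ := sin_mul_sin_le_cos_add_cos_mul_cos hαki.1 hαjk.1 hβk.1.le (by linarith)
  obtain ⟨S, hS⟩ : ∃ S, S = Real.sin βk * Real.cos αij + Real.sin βi * Real.cos αjk +
    Real.sin βj * Real.cos αki := ⟨_, rfl⟩
  have hSpos : 0 < S := hS ▸ sin_mul_cos_sum_pos hαij hαjk hαki hβi hβj hβk hsum hi hj hk
  have unit {a b : ℝ} (h : a ^ 2 + b ^ 2 = 1) : ‖!₂[a, b]‖ = 1 := by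
    simp [EuclideanSpace.norm_eq, h]
  have u₀ : ‖!₂[(1 : ℝ), 0]‖ = 1 := unit (by norm_num)
  have u₀' : ‖!₂[(-1 : ℝ), 0]‖ = 1 := unit (by norm_num)
  have n₀ : ‖!₂[(0 : ℝ), 1]‖ = 1 := unit (by norm_num)
  have ui : ‖!₂[Real.cos βi, Real.sin βi]‖ = 1 := unit (by linarith)
  have ui' : ‖!₂[-Real.cos βi, -Real.sin βi]‖ = 1 := unit (by linarith)
  have ni : ‖!₂[Real.sin βi, -Real.cos βi]‖ = 1 := unit (by linarith)
  have uj : ‖!₂[-Real.cos βj, Real.sin βj]‖ = 1 := unit (by linarith)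
  have uj' : ‖!₂[Real.cos βj, -Real.sin βj]‖ = 1 := unit (by linarith)
  have nj : ‖!₂[-Real.sin βj, -Real.cos βj]‖ = 1 := unit (by linarith)
  have lij : 0 < S * Real.sin βk := mul_pos hSpos sk
  have ljk : 0 < S * Real.sin βi := mul_pos hSpos si
  have lki : 0 < S * Real.sin βj := mul_pos hSpos sj
  have hR : 0 < Real.sin βi * Real.sin βj * Real.sin βk := by positivity
  obtain ⟨R, hRdef⟩ : ∃ R, R = Real.sin βi * Real.sin βj * Real.sin βk := ⟨_, rfl⟩
  rw [← hRdef] at hR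
  obtain ⟨i, hi⟩ : ∃ i : E2, i = !₂[0, 0] := ⟨_, rfl⟩
  obtain ⟨j, hj⟩ : ∃ j : E2, j = !₂[S * Real.sin βk, 0] := ⟨_, rfl⟩
  obtain ⟨k, hk⟩ : ∃ k : E2,
    k = !₂[S * Real.sin βj * Real.cos βi, S * Real.sin βj * Real.sin βi] := ⟨_, rfl⟩
  obtain ⟨O, hO⟩ : ∃ O : E2,
    O = !₂[Real.sin βj * Real.sin βk * (Real.cos αki + Real.cos αij * Real.cos βi),
      R * Real.cos αij] := ⟨_, rfl⟩
  have hAi : ∠ j i k = βi := by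
    refine angle_eq_of_inner_eq_cos u₀ ui lij lki hβi ?_ ?_ ?_
    · simp [PiLp.inner_apply]
    · rw [hi, hj]; ext t; fin_cases t <;> simp
    · rw [hi, hk]; ext t; fin_cases t <;> simp
  have hAj : ∠ i j k = βj := by
    refine angle_eq_of_inner_eq_cos u₀' uj lij ljk hβj ?_ ?_ ?_
    · simp [PiLp.inner_apply]
    · rw [hi, hj]; ext t; fin_cases t <;> simp
    · rw [hj, hk]; ext t; fin_cases t <;> simp
      · rw [esk]; ring
      · ring
  have hAk : ∠ i k j = βk := by
    refine angle_eq_of_inner_eq_cos ui' uj' lki ljk hβk ?_ ?_ ?_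
    · simp [PiLp.inner_apply]
      rw [eck]; ring
    · rw [hi, hk]; ext t; fin_cases t <;> simp
    · rw [hj, hk]; ext t; fin_cases t <;> simp
      · rw [esk]; ring
      · ring
  have hE₁ := faceCircleCrossesEdge_of_frame (u := i) (v := j) (w := k) (O := O) (R := R)
    (α := αij) (x := Real.sin βj * Real.sin βk * (Real.cos αki + Real.cos αij * Real.cos βi))
    (p := S * Real.sin βj * Real.cos βi) (q := S * Real.sin βj * Real.sin βi)
    u₀ n₀ (by simp [PiLp.inner_apply]) lij (by positivity) hR.le hij
    (by rw [hRdef]; linarith [mul_le_mul_of_nonneg_left i₁ (mul_pos sj sk).le])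
    (by
      have : S * Real.sin βk -
          Real.sin βj * Real.sin βk * (Real.cos αki + Real.cos αij * Real.cos βi) =
          Real.sin βi * Real.sin βk * (Real.cos αjk + Real.cos αij * Real.cos βj) := by
        rw [hS]; linear_combination Real.sin βk * Real.cos αij * esk
      rw [this, hRdef]
      linarith [mul_le_mul_of_nonneg_left j₁ (mul_pos si sk).le])
    (by rw [hi, hj]; ext t; fin_cases t <;> simp)
    (by rw [hi, hk]; ext t; fin_cases t <;> simp)
    (by rw [hi, hO]; ext t; fin_cases t <;> simp)
  have hE₂ := faceCircleCrossesEdge_of_frame (u := j) (v := k) (w := i) (O := O) (R := R)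
    (α := αjk) (x := Real.sin βi * Real.sin βk * (Real.cos αij + Real.cos αjk * Real.cos βj))
    (p := S * Real.sin βk * Real.cos βj) (q := S * Real.sin βk * Real.sin βj)
    uj nj (by simp [PiLp.inner_apply]; ring) ljk (by positivity) hR.le hjk
    (by rw [hRdef]; linarith [mul_le_mul_of_nonneg_left j₂ (mul_pos si sk).le])
    (by
      have : S * Real.sin βi -
          Real.sin βi * Real.sin βk * (Real.cos αij + Real.cos αjk * Real.cos βj) =
          Real.sin βi * Real.sin βj * (Real.cos αki + Real.cos αjk * Real.cos βk) := by
        rw [hS]; linear_combination Real.sin βi * Real.cos αjk * ei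
      rw [this, hRdef]
      linarith [mul_le_mul_of_nonneg_left k₁ (mul_pos si sj).le])
    (by
      rw [hj, hk]; ext t; fin_cases t <;> simp
      · rw [esk]; ring
      · ring)
    (by
      rw [hi, hj]; ext t; fin_cases t <;> simp
      · linear_combination S * Real.sin βk * tj
      · ring)
    (by
      rw [hj, hO, hRdef, hS]; ext t; fin_cases t <;> simp
      · linear_combination -(Real.sin βk * Real.cos αij) * esk + Real.sin βi * Real.sin βk * Real.cos αjk * tj
      · ring)
  have hE₃ := faceCircleCrossesEdge_of_frame (u := k) (v := i) (w := j) (O := O) (R := R)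
    (α := αki) (x := Real.sin βi * Real.sin βj * (Real.cos αjk + Real.cos αki * Real.cos βk))
    (p := S * Real.sin βi * Real.cos βk) (q := S * Real.sin βi * Real.sin βk)
    ui' ni (by simp [PiLp.inner_apply]; ring) lki (by positivity) hR.le hki
    (by rw [hRdef]; linarith [mul_le_mul_of_nonneg_left k₂ (mul_pos si sj).le])
    (by
      have : S * Real.sin βj -
          Real.sin βi * Real.sin βj * (Real.cos αjk + Real.cos αki * Real.cos βk) =
          Real.sin βj * Real.sin βk * (Real.cos αij + Real.cos αki * Real.cos βi) := by
        rw [hS]; linear_combination Real.sin βj * Real.cos αki * ej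
      rw [this, hRdef]
      linarith [mul_le_mul_of_nonneg_left i₂ (mul_pos sj sk).le])
    (by rw [hi, hk]; ext t; fin_cases t <;> simp)
    (by
      rw [hj, hk]; ext t; fin_cases t <;> simp
      · linear_combination -S * Real.cos βi * ej - S * Real.sin βk * ti
      · linear_combination -S * Real.sin βi * ej)
    (by
      rw [hk, hO, hRdef, hS]; ext t; fin_cases t <;> simp
      · linear_combination Real.sin βj * Real.cos αki * (-Real.cos βi * ej - Real.sin βk * ti)
      · linear_combination -Real.sin βi * Real.sin βj * Real.cos αki * ej)
  refine ⟨i, j, k, O, R, hR, ?_, hAi, hAj, hAk, hE₁.1, hE₂.1, hE₃.1, hE₁.2.1, hE₂.2.1, hE₃.2.1,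
    hE₁.2.2, hE₂.2.2, hE₃.2.2⟩
  rw [affineIndependent_iff_not_collinear_set, Set.insert_comm,
    collinear_iff_eq_or_eq_or_angle_eq_zero_or_angle_eq_pi]
  rintro (h | h | h | h)
  · have := congrArg (fun P : E2 => P 0) h
    simp [hi, hj, hSpos.ne', sk.ne'] at this
  · have := congrArg (fun P : E2 => P 1) h
    simp [hi, hk, hSpos.ne', si.ne', sj.ne'] at this
  · exact hβi.1.ne' (hAi.symm.trans h)
  · exact hβi.2.ne (hAi.symm.trans h)
end
end

section
/- Let i, j, k be affinely independent points of the Euclidean plane, O a point and R > 0 with dist(O,u) ≥ R for each u ∈ {i,j,k}; set r_u = √(dist(O,u)² − R²) and assume dist(u,v) ≥ r_u + r_v for each of the three edges. Assume moreover that for each edge — e.g. for ij with opposite vertex k — writing F for the orthogonal projection of O onto the line through i and j and n for the unit vector orthogonal to j − i with ⟪k − F, n⟫ > 0, one has O = F + d_ij·n with |d_ij| ≤ R, and define α_ij = Real.arccos(d_ij/R) ∈ [0,π] (similarly α_jk and α_ki). Then, with β_i = ∠ j i k, β_j = ∠ i j k, β_k = ∠ i k j, the following hold: α_ij + β_i +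 α_ki ≤ π with equality if and only if dist(O,i) = R; α_ij + β_j + α_jk ≤ π with equality if and only if dist(O,j) = R; and α_jk + β_k + α_ki ≤ π with equality if and only if dist(O,k) = R. -/
open scoped RealInnerProductSpace
open Real EuclideanGeometry

noncomputable section

/-- `d` is the signed distance from the point `O` to the line through `u` and `v`,
measured positively on the side containing the opposite vertex `w`: if `F` is the
orthogonal projection of `O` onto the line (characterized by `F` lying on the line
with `O - F` orthogonal to `v - u`) and `n` is the unit normal of the line with
`⟪w − F, n⟫ > 0`, then `O = F + d·n`. -/
def SignedDistToEdge (u v w O : E2) (d : ℝ) : Prop :=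
  ∃ F n : E2, F ∈ affineSpan ℝ ({u, v} : Set E2) ∧ ⟪O - F, v - u⟫ = 0 ∧
    ‖n‖ = 1 ∧ ⟪n, v - u⟫ = 0 ∧ 0 < ⟪w - F, n⟫ ∧
    O = F + d • n

/-- For `1 < t`, the function `x ↦ arcsin (t * sin x) - x` is odd and strictly increasing where
`|t * sin x| ≤ 1`; stated here as the resulting inequality for two angles of positive sum. -/
lemma add_lt_arcsin_mul_sin_add {t θ φ : ℝ} (ht : 1 < t)
    (hθ : θ ≤ π / 2) (hφ : φ ≤ π / 2) (hpos : 0 < θ + φ)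
    (hsθ : t * sin θ ≤ 1) (hsφ : t * sin φ ≤ 1) :
    θ + φ < arcsin (t * sin θ) + arcsin (t * sin φ) := by
  have hmono : StrictMonoOn (fun x => arcsin (t * sin x) - x) (Set.Icc (-φ) θ) := by
    refine strictMonoOn_of_deriv_pos (convex_Icc _ _) (by fun_prop) fun x hx => ?_
    rw [interior_Icc] at hx
    obtain ⟨hx₁, hx₂⟩ := hx
    have hcos : 0 < cos x := cos_pos_of_mem_Ioo ⟨by linarith, by linarith⟩
    have hlt : t * sin x < 1 :=
      (mul_lt_mul_of_pos_left (sin_lt_sin_of_lt_of_le_pi_div_two (by linarith) hθ hx₂)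
        (by linarith)).trans_le hsθ
    have hgt : -1 < t * sin x := by
      have h := mul_lt_mul_of_pos_left
        (sin_lt_sin_of_lt_of_le_pi_div_two (x := -φ) (y := x) (by linarith) (by linarith) hx₁)
        (by linarith : 0 < t)
      rw [sin_neg] at h
      linarith
    have hd : HasDerivAt (fun x => arcsin (t * sin x) - x)
        (1 / √(1 - (t * sin x) ^ 2) * (t * cos x) - 1) x :=
      (HasDerivAt.comp (h₂ := arcsin) x (hasDerivAt_arcsin hgt.ne' hlt.ne)
        ((hasDerivAt_sin x).const_mul t)).fun_sub (hasDerivAt_id' x)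
    rw [hd.deriv, sub_pos, one_div_mul_eq_div, one_lt_div (sqrt_pos.2 (by nlinarith))]
    rw [sqrt_lt' (by positivity)]
    rw [mul_pow, mul_pow, cos_sq']
    nlinarith
  have h := hmono (Set.left_mem_Icc.2 (by linarith)) (Set.right_mem_Icc.2 (by linarith))
    (by linarith : -φ < θ)
  simp only [sin_neg, mul_neg, arcsin_neg] at h
  linarith

/-- The cross product of two plane vectors. -/
def planeCross (x y : E2) : ℝ := x 0 * y 1 - x 1 * y 0

lemma real_inner_E2 (x y : E2) : ⟪x, y⟫ = x 0 * y 0 + x 1 * y 1 := by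
  simp [PiLp.inner_apply, Fin.sum_univ_two, mul_comm]

lemma norm_sq_E2 (x : E2) : ‖x‖ ^ 2 = x 0 ^ 2 + x 1 ^ 2 := by
  rw [← real_inner_self_eq_norm_sq, real_inner_E2]
  ring

lemma SignedDistToEdge.symm {u v w O : E2} {d : ℝ} (h : SignedDistToEdge u v w O d) :
    SignedDistToEdge v u w O d := by
  obtain ⟨F, n, hF, hO, hn, hnu, hw, h⟩ := h
  refine ⟨F, n, Set.pair_comm u v ▸ hF, ?_, hn, ?_, hw, h⟩
  · rw [← neg_sub v u, inner_neg_right, hO, neg_zero]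
  · rw [← neg_sub v u, inner_neg_right, hnu, neg_zero]

/-- The signed distance in terms of the cross product, with the sign `ε` of the triangle. -/
lemma SignedDistToEdge.exists_sign {u v w O : E2} {d : ℝ} (h : SignedDistToEdge u v w O d)
    (huv : u ≠ v) :
    ∃ ε : ℝ, ε ^ 2 = 1 ∧ 0 < ε * planeCross (v - u) (w - u) ∧
      d * ‖v - u‖ = ε * planeCross (v - u) (O - u) := by
  obtain ⟨F, n, hF, -, hn, hnu, hw, rfl⟩ := h
  obtain ⟨r, rfl⟩ := mem_affineSpan_pair_iff_exists_lineMap_eq.1 hF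
  have hl : 0 < ‖v - u‖ := norm_pos_iff.2 (sub_ne_zero.2 huv.symm)
  have hl2 := norm_sq_E2 (v - u)
  have hn2 := norm_sq_E2 n
  rw [hn] at hn2
  rw [real_inner_E2] at hnu hw
  simp only [AffineMap.lineMap_apply, vsub_eq_sub, vadd_eq_add, PiLp.sub_apply, PiLp.add_apply,
    PiLp.smul_apply, smul_eq_mul, planeCross] at *
  set l := ‖v - u‖
  set a := v 0 - u 0
  set b := v 1 - u 1
  have key : (-b * n 0 + a * n 1) ^ 2 = l ^ 2 := by
    linear_combination -(n 0 * a + n 1 * b) * hnu - (n 0 ^ 2 + n 1 ^ 2) * hl2 - l ^ 2 * hn2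
  have h0 : l ^ 2 * n 0 = -b * (-b * n 0 + a * n 1) := by
    linear_combination n 0 * hl2 + a * hnu
  have h1 : l ^ 2 * n 1 = a * (-b * n 0 + a * n 1) := by
    linear_combination n 1 * hl2 + b * hnu
  refine ⟨(-b * n 0 + a * n 1) / l, ?_, ?_, ?_⟩
  · rw [div_pow, key, div_self (by positivity)]
  · rw [div_mul_eq_mul_div]
    refine div_pos ?_ hl
    have : 0 < l ^ 2 * ((w 0 - (r * a + u 0)) * n 0 + (w 1 - (r * b + u 1)) * n 1) := by
      positivity
    linear_combination this + (w 0 - u 0) * h0 + (w 1 - u 1) * h1 - l ^ 2 * r * hnu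
  · field_simp
    linear_combination -d * key

/-- If the vertex circles at `u` and `v` have disjoint interiors, then the foot of the
perpendicular from `O` to the line `uv` is on the same side of `u` as `v`. -/
lemma inner_nonneg_of_sqrt_add_sqrt_le {u v O : E2} {R : ℝ} (hR : 0 ≤ R)
    (hu : R ≤ dist O u) (hv : R ≤ dist O v)
    (h : √(dist O u ^ 2 - R ^ 2) + √(dist O v ^ 2 - R ^ 2) ≤ dist u v) :
    0 ≤ ⟪O - u, v - u⟫ := by
  have hu2 := sq_sqrt (sub_nonneg.2 (pow_le_pow_left₀ hR hu 2))
  have hv2 := sq_sqrt (sub_nonneg.2 (pow_le_pow_left₀ hR hv 2))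
  have hu0 := sqrt_nonneg (dist O u ^ 2 - R ^ 2)
  have hv0 := sqrt_nonneg (dist O v ^ 2 - R ^ 2)
  have hn := norm_sub_sq_real (O - u) (v - u)
  rw [sub_sub_sub_cancel_right, ← dist_eq_norm, ← dist_eq_norm, ← dist_eq_norm,
    dist_comm v u] at hn
  have := pow_le_pow_left₀ (add_nonneg hu0 hv0) h 2
  nlinarith [mul_nonneg hu0 hv0]

/-- The angle inequality at the vertex `a` of a decorated triangle `abc`. -/
lemma decorated_triangle_angle_inequality_at_vertex {a b c O : E2} {R d e : ℝ}
    (hab : a ≠ b) (hac : a ≠ c) (hR : 0 < R)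
    (ha : R ≤ dist O a) (hb : R ≤ dist O b) (hc : R ≤ dist O c)
    (hrab : √(dist O a ^ 2 - R ^ 2) + √(dist O b ^ 2 - R ^ 2) ≤ dist a b)
    (hrac : √(dist O a ^ 2 - R ^ 2) + √(dist O c ^ 2 - R ^ 2) ≤ dist a c)
    (hd : SignedDistToEdge a b c O d) (hdR : |d| ≤ R)
    (he : SignedDistToEdge a c b O e) (heR : |e| ≤ R) :
    arccos (d / R) + ∠ b a c + arccos (e / R) ≤ π ∧
      (arccos (d / R) + ∠ b a c + arccos (e / R) = π ↔ dist O a = R) := by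
  have hPU := inner_nonneg_of_sqrt_add_sqrt_le hR.le ha hb hrab
  have hPV := inner_nonneg_of_sqrt_add_sqrt_le hR.le ha hc hrac
  obtain ⟨ε, hε, hεpos, hdε⟩ := hd.exists_sign hab
  obtain ⟨δ, hδ, hδpos, heδ⟩ := he.exists_sign hac
  have hU : 0 < ‖b - a‖ := norm_pos_iff.2 (sub_ne_zero.2 hab.symm)
  have hV : 0 < ‖c - a‖ := norm_pos_iff.2 (sub_ne_zero.2 hac.symm)
  have hρ : 0 < ‖O - a‖ := by rw [← dist_eq_norm]; linarith
  have hcosβ : cos (∠ b a c) = ⟪b - a, c - a⟫ / (‖b - a‖ * ‖c - a‖) :=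
    InnerProductGeometry.cos_angle _ _
  have hβ0 : 0 ≤ ∠ b a c := angle_nonneg _ _ _
  have hβπ : ∠ b a c ≤ π := angle_le_pi _ _ _
  rw [dist_eq_norm] at ha ⊢
  have hU2 := norm_sq_E2 (b - a)
  have hV2 := norm_sq_E2 (c - a)
  have hρ2 := norm_sq_E2 (O - a)
  rw [real_inner_E2] at hPU hPV hcosβ
  generalize ∠ b a c = β at *
  generalize ‖b - a‖ = lU at *
  generalize ‖c - a‖ = lV at *
  generalize ‖O - a‖ = ρ at *
  unfold planeCross at *
  generalize (b - a) 0 = x at *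
  generalize (b - a) 1 = y at *
  generalize (c - a) 0 = z at *
  generalize (c - a) 1 = w at *
  generalize (O - a) 0 = p at *
  generalize (O - a) 1 = q at *
  obtain rfl : δ = -ε := by
    have h : (δ - ε) * (δ + ε) = 0 := by linear_combination hδ - hε
    rcases mul_eq_zero.1 h with h | h
    · obtain rfl : δ = ε := by linarith
      nlinarith
    · linarith
  have hsinβ : sin β = ε * (x * w - y * z) / (lU * lV) := by
    rw [← sq_eq_sq₀ (sin_nonneg_of_nonneg_of_le_pi hβ0 hβπ) (by positivity), sin_sq, hcosβ]
    field_simp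
    rw [hε, hU2, hV2]
    ring
  have hdρ := abs_le.1 (hdR.trans ha)
  have heρ := abs_le.1 (heR.trans ha)
  have hβpos : 0 < β := by
    refine hβ0.lt_of_ne fun h => ?_
    rw [← h, sin_zero] at hsinβ
    have : 0 < ε * (x * w - y * z) / (lU * lV) := by positivity
    linarith
  have hβlt : β < π := by
    refine hβπ.lt_of_ne fun h => ?_
    rw [h, sin_pi] at hsinβ
    have : 0 < ε * (x * w - y * z) / (lU * lV) := by positivity
    linarith
  obtain ⟨θ, hθ⟩ : ∃ θ, θ = arcsin (d / ρ) := ⟨_, rfl⟩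
  have hθ1 : -(π / 2) ≤ θ := hθ ▸ neg_pi_div_two_le_arcsin _
  have hθ2 : θ ≤ π / 2 := hθ ▸ arcsin_le_pi_div_two _
  have hsinθ : sin θ = d / ρ := by
    rw [hθ, sin_arcsin] <;> [rw [le_div_iff₀ hρ]; rw [div_le_iff₀ hρ]] <;> linarith
  have hcosθ : cos θ = (p * x + q * y) / (lU * ρ) := by
    rw [← sq_eq_sq₀ (cos_nonneg_of_neg_pi_div_two_le_of_le hθ1 hθ2) (by positivity), cos_sq',
      hsinθ]
    field_simp
    have : lU ^ 2 * d ^ 2 = (x * q - y * p) ^ 2 := by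
      linear_combination (d * lU + ε * (x * q - y * p)) * hdε + (x * q - y * p) ^ 2 * hε
    rw [sub_mul, mul_comm (d ^ 2), this, hU2, hρ2]
    ring
  have hsinφ : sin (β - θ) = e / ρ := by
    rw [sin_sub, hsinβ, hcosβ, hsinθ, hcosθ]
    have hd' : d = ε * (x * q - y * p) / lU := by rw [eq_div_iff hU.ne', hdε]
    have he' : e = -ε * (z * q - w * p) / lV := by rw [eq_div_iff hV.ne', heδ]
    rw [hd', he']
    field_simp
    rw [hU2]
    ring
  have hcosφ : 0 ≤ cos (β - θ) := by
    have : cos (β - θ) = (p * z + q * w) / (lV * ρ) := by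
      rw [cos_sub, hsinβ, hcosβ, hsinθ, hcosθ]
      have hd' : d = ε * (x * q - y * p) / lU := by rw [eq_div_iff hU.ne', hdε]
      rw [hd']
      field_simp
      rw [hU2]
      linear_combination (x * w - y * z) * (x * q - y * p) * hε
    rw [this]
    positivity
  have hφ2 : β - θ ≤ π / 2 := by
    by_contra! h
    exact hcosφ.not_gt (cos_neg_of_pi_div_two_lt_of_lt h (by linarith))
  have hdt : d / R = ρ / R * sin θ := by rw [hsinθ]; field_simp
  have het : e / R = ρ / R * sin (β - θ) := by rw [hsinφ]; field_simp
  rcases ha.eq_or_lt with h | h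
  · subst h
    have h1 : arcsin (d / R) = θ := hθ.symm
    have h2 : arcsin (e / R) = β - θ := by
      rw [← hsinφ, arcsin_sin (by linarith) hφ2]
    have : arccos (d / R) + β + arccos (e / R) = π := by
      rw [arccos, arccos, h1, h2]
      ring
    exact ⟨this.le, iff_of_true this rfl⟩
  · have key := add_lt_arcsin_mul_sin_add ((one_lt_div hR).2 h) hθ2 hφ2 (by linarith)
      (by rw [← hdt, div_le_one hR]; exact (abs_le.1 hdR).2)
      (by rw [← het, div_le_one hR]; exact (abs_le.1 heR).2)
    rw [← hdt, ← het] at key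
    have : arccos (d / R) + β + arccos (e / R) < π := by
      rw [arccos, arccos]
      linarith
    exact ⟨this.le, iff_of_false this.ne h.ne'⟩

/-- For a Euclidean decorated triangle `ijk` with face circle
`(O,R)`, vertex radii `r_u = √(dist(O,u)² − R²)` and disjoint vertex circle interiors,
let `d_uv` be the signed distance from `O` to each edge line (positive towards the
opposite vertex), with `|d_uv| ≤ R`, and let `α_uv = arccos (d_uv / R)` be the angle at
which the face circle crosses the edge `uv`.  Then, with `β_u` the triangle angles, one
has `α_ij + β_i + α_ki ≤ π` with equality iff `dist(O,i) = R` (the vertex circle at `i`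
degenerates to a point on the face circle), and similarly at `j` and `k`. -/
theorem decorated_triangle_angle_inequalities
    (i j k O : E2) (R dij djk dki : ℝ)
    (hind : AffineIndependent ℝ ![i, j, k]) (hR : 0 < R)
    (hOi : R ≤ dist O i) (hOj : R ≤ dist O j) (hOk : R ≤ dist O k)
    (hij : Real.sqrt (dist O i ^ 2 - R ^ 2) + Real.sqrt (dist O j ^ 2 - R ^ 2)
      ≤ dist i j)
    (hjk : Real.sqrt (dist O j ^ 2 - R ^ 2) + Real.sqrt (dist O k ^ 2 - R ^ 2)
      ≤ dist j k)
    (hki : Real.sqrt (dist O k ^ 2 - R ^ 2) + Real.sqrt (dist O i ^ 2 - R ^ 2)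
      ≤ dist k i)
    (hdij : SignedDistToEdge i j k O dij) (hdij' : |dij| ≤ R)
    (hdjk : SignedDistToEdge j k i O djk) (hdjk' : |djk| ≤ R)
    (hdki : SignedDistToEdge k i j O dki) (hdki' : |dki| ≤ R) :
    (Real.arccos (dij / R) + ∠ j i k + Real.arccos (dki / R) ≤ π ∧
      (Real.arccos (dij / R) + ∠ j i k + Real.arccos (dki / R) = π ↔ dist O i = R)) ∧
    (Real.arccos (dij / R) + ∠ i j k + Real.arccos (djk / R) ≤ π ∧
      (Real.arccos (dij / R) + ∠ i j k + Real.arccos (djk / R) = π ↔ dist O j = R)) ∧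
    (Real.arccos (djk / R) + ∠ i k j + Real.arccos (dki / R) ≤ π ∧
      (Real.arccos (djk / R) + ∠ i k j + Real.arccos (dki / R) = π ↔ dist O k = R)) := by
  have hne : i ≠ j ∧ j ≠ k ∧ k ≠ i := by
    refine ⟨?_, ?_, ?_⟩
    · simpa using hind.injective.ne (show (0 : Fin 3) ≠ 1 by decide)
    · simpa using hind.injective.ne (show (1 : Fin 3) ≠ 2 by decide)
    · simpa using hind.injective.ne (show (2 : Fin 3) ≠ 0 by decide)
  obtain ⟨hne_ij, hne_jk, hne_ki⟩ := hne
  refine ⟨?_, ?_, ?_⟩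
  · exact decorated_triangle_angle_inequality_at_vertex hne_ij hne_ki.symm hR hOi hOj hOk hij
      (by rwa [add_comm, dist_comm i k]) hdij hdij' hdki.symm hdki'
  · exact decorated_triangle_angle_inequality_at_vertex hne_ij.symm hne_jk hR hOj hOi hOk
      (by rwa [add_comm, dist_comm j i]) hjk hdij.symm hdij' hdjk hdjk'
  · rw [angle_comm]
    exact decorated_triangle_angle_inequality_at_vertex hne_jk.symm hne_ki hR hOk hOj hOi
      (by rwa [add_comm, dist_comm k j]) hki hdjk.symm hdjk' hdki hdki'
end
end
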